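/- Let G be a connected reduced graph with minimum degree at least 3, let uvzwu be a 4-cycle in G, and let G/π be the graph obtained from G by the π-reduction on this 4-cycle, with the new edge e_π = xy (where x is the identification of u and z, and y is the identification of v and w). Then G/π has at most two nontrivial maximal collapsible subgraphs, and every nontrivial maximal collapsible subgraph H₀ of G/π contains exactly one of the two vertices x and y (i.e., |V(H₀) ∩ {x, y}| = 1). -/

import Mathlib

open scoped Classical

/-- A finite loopless multigraph on vertex type `V`, given by a multiset of edges. -/
structure Multigraph (V : Type) where
  edges : Multiset (Sym2 V)
  loopless : ∀ e ∈ edges, ¬ e.IsDiag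

namespace Multigraph

variable {V W : Type}

/-- The degree of a vertex with respect to a multiset of edges. -/
noncomputable def degIn (E : Multiset (Sym2 V)) (v : V) : ℕ :=
  Multiset.card (E.filter fun e => v ∈ e)

/-- The degree of a vertex in a multigraph. -/
noncomputable def deg (G : Multigraph V) (v : V) : ℕ :=
  degIn G.edges v

/-- All endpoints of the edges in `E` lie in `S`. -/
def Within (S : Set V) (E : Multiset (Sym2 V)) : Prop :=
  ∀ e ∈ E, ∀ v ∈ e, v ∈ S

/-- The graph with vertex set `S` and edge multiset `E` is connected (and spans `S`). -/
def ConnOn (S : Set V) (E : Multiset (Sym2 V)) : Prop :=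
  S.Nonempty ∧ Within S E ∧
    ∀ u ∈ S, ∀ v ∈ S, Relation.ReflTransGen (fun a b => s(a, b) ∈ E) u v

/-- The graph with vertex set `S` and edge multiset `E` is collapsible: for every even subset
`R` of `S` there is a spanning connected subgraph whose set of odd-degree vertices is `R`. -/
def CollapsiblePair (S : Set V) (E : Multiset (Sym2 V)) : Prop :=
  S.Nonempty ∧ Within S E ∧
    ∀ R : Set V, R ⊆ S → R.Finite → Even R.ncard →
      ∃ E' ≤ E, ConnOn S E' ∧ ∀ x ∈ S, (Odd (degIn E' x) ↔ x ∈ R)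

/-- `(S, E)` is a subgraph of `G`. -/
def IsSubpair (G : Multigraph V) (S : Set V) (E : Multiset (Sym2 V)) : Prop :=
  E ≤ G.edges ∧ Within S E

/-- A multigraph is reduced if it has no collapsible subgraph with more than one vertex. -/
def Reduced (G : Multigraph V) : Prop :=
  ∀ S E, G.IsSubpair S E → CollapsiblePair S E → S.ncard ≤ 1

/-- `(S, E)` is a maximal collapsible subgraph of `G`. -/
def MaxCollapsibleSub (G : Multigraph V) (S : Set V) (E : Multiset (Sym2 V)) : Prop :=
  G.IsSubpair S E ∧ CollapsiblePair S E ∧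
    ∀ S' E', G.IsSubpair S' E' → CollapsiblePair S' E' → S ⊆ S' → E ≤ E' → S' = S ∧ E' = E

/-- `(S, E)` is a nontrivial maximal collapsible subgraph of `G`. -/
def NontrivMaxCollapsible (G : Multigraph V) (S : Set V) (E : Multiset (Sym2 V)) : Prop :=
  G.MaxCollapsibleSub S E ∧ 1 < S.ncard

/-- The multiset of edges of `G` with both ends in `S`. -/
noncomputable def inducedEdges (G : Multigraph V) (S : Set V) : Multiset (Sym2 V) :=
  G.edges.filter fun e => ∀ v ∈ e, v ∈ S

/-- `S` is the vertex set of a maximal collapsible subgraph of `G`. -/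
def IsMaxCollapsibleSet (G : Multigraph V) (S : Set V) : Prop :=
  CollapsiblePair S (G.inducedEdges S) ∧
    ∀ T : Set V, S ⊆ T → CollapsiblePair T (G.inducedEdges T) → T = S

/-- `G'` (on vertex type `W`) is the reduction of `G`, witnessed by the contraction map `f`:
the fibres of `f` are exactly the (vertex sets of the) maximal collapsible subgraphs of `G`,
and the edges of `G'` are obtained by contracting each fibre to a point and deleting the
resulting loops. -/
def IsReduction (G : Multigraph V) (f : V → W) (G' : Multigraph W) : Prop :=
  Function.Surjective f ∧ (∀ w : W, G.IsMaxCollapsibleSet (f ⁻¹' {w})) ∧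
    G'.edges = (G.edges.map (Sym2.map f)).filter fun e => ¬ e.IsDiag

/-- A multigraph is supereulerian if it has a spanning connected subgraph in which every
vertex has even degree. -/
def Supereulerian (G : Multigraph V) : Prop :=
  ∃ E' ≤ G.edges, ConnOn Set.univ E' ∧ ∀ x : V, Even (degIn E' x)

/-- A multigraph is connected. -/
def Connected (G : Multigraph V) : Prop :=
  ConnOn Set.univ G.edges

/-- A multigraph is 3-edge-connected (edge connectivity at least 3): removing any at most two
edges leaves a spanning connected graph. -/
def ThreeEdgeConnected (G : Multigraph V) : Prop :=
  ∀ F : Multiset (Sym2 V), F ≤ G.edges → Multiset.card F ≤ 2 →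
    ConnOn Set.univ (G.edges - F)

/-- A spanning tree: spanning connected with `|V| - 1` edges. -/
def IsSpanningTree [Fintype V] (E : Multiset (Sym2 V)) : Prop :=
  ConnOn Set.univ E ∧ Multiset.card E = Fintype.card V - 1

/-- The edge multiset `E` contains two edge-disjoint spanning trees. -/
def HasTwoDisjointSpanningTrees [Fintype V] (E : Multiset (Sym2 V)) : Prop :=
  ∃ T₁ T₂ : Multiset (Sym2 V), T₁ + T₂ ≤ E ∧ IsSpanningTree T₁ ∧ IsSpanningTree T₂

/-- `F(G)`: the minimum number of extra (loopless) edges whose addition to `G` produces a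
spanning supergraph having two edge-disjoint spanning trees. -/
noncomputable def FVal [Fintype V] (G : Multigraph V) : ℕ :=
  sInf {k : ℕ | ∃ Eadd : Multiset (Sym2 V), (∀ e ∈ Eadd, ¬ e.IsDiag) ∧
    Multiset.card Eadd = k ∧ HasTwoDisjointSpanningTrees (G.edges + Eadd)}

/-- `σ̄₂(G)`: the minimum of `deg u + deg v` over edges `uv` of `G`. -/
noncomputable def sigma2bar (G : Multigraph V) : ℕ :=
  sInf {k : ℕ | ∃ u v : V, s(u, v) ∈ G.edges ∧ G.deg u + G.deg v = k}

/-- `G` contains a cycle of length four. -/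
def HasFourCycle (G : Multigraph V) : Prop :=
  ∃ a b c d : V, a ≠ b ∧ a ≠ c ∧ a ≠ d ∧ b ≠ c ∧ b ≠ d ∧ c ≠ d ∧
    s(a, b) ∈ G.edges ∧ s(b, c) ∈ G.edges ∧ s(c, d) ∈ G.edges ∧ s(d, a) ∈ G.edges

/-- `M` is a matching: distinct edges share no endpoint. -/
def IsMatching (M : Multiset (Sym2 V)) : Prop :=
  M.Nodup ∧ ∀ e ∈ M, ∀ f ∈ M, e ≠ f → ∀ x : V, x ∈ e → x ∉ f

/-- `{X, Y}` is a bipartition (of the full vertex set) for the edge multiset `E`: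
every edge has one end in `X` and one end in `Y`. -/
def IsBipartition [Fintype V] (X Y : Finset V) (E : Multiset (Sym2 V)) : Prop :=
  Disjoint X Y ∧ X ∪ Y = Finset.univ ∧
    ∀ e ∈ E, (∃ a ∈ e, a ∈ X) ∧ (∃ b ∈ e, b ∈ Y)

/-- The edge multiset of Catlin's π-reduction `G/π` obtained from the induced four-cycle
`u v z w`: remove the four cycle edges, identify `z` with `u` (forming `x = u`) and `w` with
`v` (forming `y = v`), and add the new edge `e_π = xy = s(u, v)`. -/
noncomputable def piEdges (G : Multigraph V) (u v z w : V) : Multiset (Sym2 V) :=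
  ((G.edges - {s(u, v), s(v, z), s(z, w), s(w, u)}).map
      (Sym2.map fun a => if a = z then u else if a = w then v else a)) + {s(u, v)}

/-- `(S, E)` is the multigraph `Φ(c, t)`: a star `K_{1,t}` with centre `c` in which every
edge is doubled. -/
def IsPhi (S : Set V) (E : Multiset (Sym2 V)) (c : V) (t : ℕ) : Prop :=
  ∃ A : Finset V, c ∉ A ∧ A.card = t ∧ S = insert c (↑A : Set V) ∧
    E = A.val.map (fun a => s(c, a)) + A.val.map (fun a => s(c, a))

/-- The multigraph associated with a simple graph. -/
noncomputable def ofSimple [Fintype V] (G : SimpleGraph V) : Multigraph V where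
  edges := G.edgeSet.toFinset.val
  loopless := by
    intro e he
    have he' : e ∈ G.edgeSet := by simpa using he
    exact G.not_isDiag_of_mem_edgeSet he'

/-- Isomorphism of multigraphs. -/
def MIso {A B : Type} (G : Multigraph A) (H : Multigraph B) : Prop :=
  ∃ φ : A ≃ B, H.edges = G.edges.map (Sym2.map φ)

end Multigraph

/-- Vertices of the Petersen graph: the 2-element subsets of a 5-element set. -/
abbrev PetersenVert : Type := {s : Finset (Fin 5) // s.card = 2}

/-- The Petersen graph (as the Kneser graph on 2-subsets of a 5-set). -/
def petersenSimple : SimpleGraph PetersenVert :=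
  SimpleGraph.fromRel fun a b => Disjoint a.1 b.1

noncomputable def petersen : Multigraph PetersenVert :=
  Multigraph.ofSimple petersenSimple

/-- The graph `P₁₄`: obtained from the Petersen graph (outer cycle `0 1 2 3 4`, spokes
`i — i+5`, inner cycle `5 7 9 6 8 5`) by replacing the vertex `9` (whose neighbours were
`4`, `7`, `6`) by a copy of `K_{2,3}` with degree-three vertices `9`, `10` and degree-two
vertices `11`, `12`, `13`, joined to `4`, `7`, `6` respectively. -/
def p14Simple : SimpleGraph (Fin 14) :=
  SimpleGraph.fromRel fun a b =>
    (a, b) ∈ ([(0, 1), (1, 2), (2, 3), (3, 4), (4, 0), (0, 5), (1, 6), (2, 7), (3, 8),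
      (5, 7), (6, 8), (8, 5), (9, 11), (9, 12), (9, 13), (10, 11), (10, 12), (10, 13),
      (11, 4), (12, 7), (13, 6)] : List (Fin 14 × Fin 14))

noncomputable def p14 : Multigraph (Fin 14) :=
  Multigraph.ofSimple p14Simple

namespace Multigraph

section Helpers

variable {V : Type}

/-- Reachability using a multiset of edges. -/
def Reach (E : Multiset (Sym2 V)) (a b : V) : Prop :=
  Relation.ReflTransGen (fun a b => s(a, b) ∈ E) a b

lemma Reach.rfl' {E : Multiset (Sym2 V)} {a : V} : Reach E a a := Relation.ReflTransGen.refl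

lemma Reach.tr {E : Multiset (Sym2 V)} {a b c : V} (h : Reach E a b) (h' : Reach E b c) :
    Reach E a c := Relation.ReflTransGen.trans h h'

lemma Reach.sy {E : Multiset (Sym2 V)} {a b : V} (h : Reach E a b) : Reach E b a := by
  induction h with
  | refl => exact Reach.rfl'
  | tail _ h2 ih =>
    refine Reach.tr (Relation.ReflTransGen.single ?_) ih
    rwa [Sym2.eq_swap]

lemma Reach.edge {E : Multiset (Sym2 V)} {a b : V} (h : s(a, b) ∈ E) : Reach E a b :=
  Relation.ReflTransGen.single h

lemma Reach.mono {E E' : Multiset (Sym2 V)} {a b : V} (hE : E ≤ E') (h : Reach E a b) :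
    Reach E' a b := by
  induction h with
  | refl => exact Reach.rfl'
  | tail _ h2 ih => exact ih.tr (Reach.edge (Multiset.mem_of_le hE h2))

lemma Reach.bind {E E' : Multiset (Sym2 V)} {a b : V}
    (hE : ∀ p q, s(p, q) ∈ E → Reach E' p q) (h : Reach E a b) : Reach E' a b := by
  induction h with
  | refl => exact Reach.rfl'
  | tail _ h2 ih => exact ih.tr (hE _ _ h2)

lemma degIn_add (A B : Multiset (Sym2 V)) (x : V) :
    degIn (A + B) x = degIn A x + degIn B x := by
  simp [degIn]

lemma degIn_cons (e : Sym2 V) (B : Multiset (Sym2 V)) (x : V) :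
    degIn (e ::ₘ B) x = (if x ∈ e then 1 else 0) + degIn B x := by
  unfold degIn
  split_ifs with h
  · rw [Multiset.filter_cons_of_pos (p := fun e => x ∈ e) _ h, Multiset.card_cons, add_comm]
  · rw [Multiset.filter_cons_of_neg (p := fun e => x ∈ e) _ h, zero_add]

lemma degIn_zero (x : V) : degIn (0 : Multiset (Sym2 V)) x = 0 := by
  simp [degIn]

lemma degIn_singleton (e : Sym2 V) (x : V) :
    degIn ({e} : Multiset (Sym2 V)) x = (if x ∈ e then 1 else 0) := by
  rw [← Multiset.cons_zero, degIn_cons, degIn_zero, add_zero]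

lemma degIn_eq_zero {S : Set V} {E : Multiset (Sym2 V)} (h : Within S E) {x : V}
    (hx : x ∉ S) : degIn E x = 0 := by
  unfold degIn
  rw [Multiset.card_eq_zero, Multiset.filter_eq_nil]
  intro e he hxe
  exact hx (h e he x hxe)

lemma zmod_cases : ∀ x : ZMod 2, x = 0 ∨ x = 1 := by decide

lemma degIn_map [Fintype V] (f : V → V) (E : Multiset (Sym2 V))
    (h : ∀ e ∈ E.map (Sym2.map f), ¬ e.IsDiag) (x : V) :
    degIn (E.map (Sym2.map f)) x = ∑ a, if f a = x then degIn E a else 0 := by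
  induction E using Multiset.induction_on with
  | empty => simp [degIn_zero]
  | cons e E ih =>
    rw [Multiset.map_cons, degIn_cons, ih (fun e' he' => h e' (by simp at he' ⊢; tauto))]
    have h0 := h (Sym2.map f e) (by simp)
    simp only [degIn_cons]
    rw [show (∑ a, if f a = x then ((if a ∈ e then 1 else 0) + degIn E a) else 0) =
      (∑ a, if f a = x then (if a ∈ e then 1 else 0) else 0) +
        ∑ a, if f a = x then degIn E a else 0 from by
        rw [← Finset.sum_add_distrib]
        refine Finset.sum_congr rfl fun a _ => ?_
        split_ifs <;> simp]
    congr 1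
    induction e using Sym2.ind with
    | _ p q =>
      simp only [Sym2.map_mk, Sym2.mk_isDiag_iff, Sym2.mem_iff] at h0 ⊢
      have hpq : p ≠ q := fun hh => h0 (by rw [hh])
      have : ∀ a, (if f a = x then (if a = p ∨ a = q then 1 else 0) else 0) =
          (if a = p then (if x = f p then 1 else 0) else 0) +
          (if a = q then (if x = f q then 1 else 0) else 0) := by
        intro a
        by_cases hp : a = p
        · subst hp; simp [hpq, eq_comm]
        · by_cases hq : a = q
          · subst hq; simp [hp, eq_comm]
          · simp [hp, hq]
      simp only [this, Finset.sum_add_distrib, Finset.sum_ite_eq', Finset.mem_univ, if_true]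
      by_cases hp : x = f p
      · subst hp; simp [h0]
      · simp [hp]

lemma handshake [Fintype V] (E : Multiset (Sym2 V)) (h : ∀ e ∈ E, ¬ e.IsDiag) :
    ∑ x, (degIn E x : ZMod 2) = 0 := by
  induction E using Multiset.induction_on with
  | empty => simp [degIn_zero]
  | cons e E ih =>
    simp only [degIn_cons, Nat.cast_add, Finset.sum_add_distrib]
    rw [ih (fun e' he' => h e' (by simp [he'])), add_zero]
    have h0 := h e (by simp)
    induction e using Sym2.ind with
    | _ p q =>
      have hpq : p ≠ q := by simpa using h0
      have : ∀ a, (((if a ∈ s(p, q) then 1 else 0 : ℕ)) : ZMod 2) =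
          (if a = p then 1 else 0) + (if a = q then 1 else 0) := by
        intro a
        by_cases hp : a = p
        · subst hp; simp [hpq]
        · simp [hp]
      simp only [this, Finset.sum_add_distrib, Finset.sum_ite_eq', Finset.mem_univ, if_true]
      decide

lemma odd_iff_cast (n : ℕ) : Odd n ↔ (n : ZMod 2) = 1 := by
  rw [ZMod.natCast_eq_one_iff_odd]

lemma sum_ind [Fintype V] (R : Set V) :
    ∑ x, (if x ∈ R then (1 : ZMod 2) else 0) = (R.ncard : ZMod 2) := by
  rw [Finset.sum_boole, Set.ncard_eq_toFinset_card']
  congr 2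
  ext x; simp

lemma CollapsiblePair.exists_fun [Fintype V] {S : Set V} {E : Multiset (Sym2 V)}
    (h : CollapsiblePair S E) (r : V → ZMod 2) (hr : ∀ x, x ∉ S → r x = 0)
    (hs : ∑ x, r x = 0) :
    ∃ E' ≤ E, ConnOn S E' ∧ ∀ x, (degIn E' x : ZMod 2) = r x := by
  have hri : ∀ x, r x = if x ∈ {x | r x = 1} then (1 : ZMod 2) else 0 := by
    intro x
    rcases zmod_cases (r x) with h | h <;> simp [h]
  obtain ⟨E', hE', hc, hd⟩ := h.2.2 {x | r x = 1}
    (fun x hx => by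
      by_contra hxS
      have h1 : r x = 1 := hx
      rw [hr x hxS] at h1
      exact absurd h1 (by decide))
    (Set.toFinite _)
    (by
      rw [← ZMod.natCast_eq_zero_iff_even, ← sum_ind]
      refine Eq.trans ?_ hs
      exact Finset.sum_congr rfl fun x _ => by convert (hri x).symm)
  refine ⟨E', hE', hc, fun x => ?_⟩
  by_cases hx : x ∈ S
  · have := hd x hx
    rw [odd_iff_cast, Set.mem_ofPred_eq] at this
    rcases zmod_cases (r x) with h | h
    · rcases zmod_cases (degIn E' x : ZMod 2) with h' | h'
      · rw [h, h']
      · rw [h] at this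
        exact absurd (this.1 h') (by decide)
    · rw [h]
      exact this.2 h
  · rw [hr x hx, degIn_eq_zero hc.2.1 hx, Nat.cast_zero]

lemma collapsible_of_fun [Fintype V] {S : Set V} {E : Multiset (Sym2 V)}
    (h1 : S.Nonempty) (h2 : Within S E)
    (h : ∀ r : V → ZMod 2, (∀ x, x ∉ S → r x = 0) → ∑ x, r x = 0 →
      ∃ E' ≤ E, ConnOn S E' ∧ ∀ x ∈ S, (degIn E' x : ZMod 2) = r x) :
    CollapsiblePair S E := by
  refine ⟨h1, h2, fun R hR _ hev => ?_⟩
  obtain ⟨E', hE', hc, hd⟩ := h (fun x => if x ∈ R then 1 else 0)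
    (fun x hx => by
      have : x ∉ R := fun hh => hx (hR hh)
      simp [this])
    (by rw [sum_ind, ZMod.natCast_eq_zero_iff_even]; exact hev)
  refine ⟨E', hE', hc, fun x hx => ?_⟩
  rw [odd_iff_cast, hd x hx]
  by_cases hxR : x ∈ R <;> simp [hxR]

lemma collapsible_union [Fintype V] {S₁ S₂ : Set V} {E₁ E₂ : Multiset (Sym2 V)}
    (h₁ : CollapsiblePair S₁ E₁) (h₂ : CollapsiblePair S₂ E₂)
    (hl : ∀ e ∈ E₂, ¬ e.IsDiag) {t : V} (ht₁ : t ∈ S₁) (ht₂ : t ∈ S₂) :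
    CollapsiblePair (S₁ ∪ S₂) (E₁ ∪ E₂) := by
  refine collapsible_of_fun ⟨t, Or.inl ht₁⟩ ?_ ?_
  · intro e he x hx
    rcases Multiset.mem_union.1 he with he | he
    · exact Or.inl (h₁.2.1 e he x hx)
    · exact Or.inr (h₂.2.1 e he x hx)
  intro r hr hs
  obtain ⟨F, hF, hFc, hFd⟩ := h₂.exists_fun
    (fun x => (if x ∈ S₂ ∧ x ∉ S₁ then r x else 0) +
      if x = t then (∑ x, if x ∈ S₂ ∧ x ∉ S₁ then r x else 0) else 0)
    (fun x hx => by
      have : x ≠ t := fun hh => hx (hh ▸ ht₂)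
      simp [hx, this])
    (by
      rw [Finset.sum_add_distrib, Finset.sum_ite_eq' Finset.univ t]
      simp only [Finset.mem_univ, if_true]
      exact CharTwo.add_self_eq_zero _)
  set F' := F.filter (fun e => ¬ ∀ v ∈ e, v ∈ S₁) with hF'
  have hF'F : F' ≤ F := Multiset.filter_le _ _
  have hdF' : ∀ x, x ∉ S₁ → degIn F' x = degIn F x := by
    intro x hx
    unfold degIn
    rw [hF', Multiset.filter_filter]
    congr 1
    refine Multiset.filter_congr fun e _ => ?_
    constructor
    · exact fun h => h.1
    · exact fun h => ⟨h, fun hh => hx (hh x h)⟩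
  have hF'w : Within S₂ F' := fun e he => hFc.2.1 e (Multiset.mem_of_le hF'F he)
  obtain ⟨K, hK, hKc, hKd⟩ := h₁.exists_fun (fun x => r x + (degIn F' x : ZMod 2))
    (fun x hx => by
      by_cases hx2 : x ∈ S₂
      · have hxt : x ≠ t := fun hh => hx (hh ▸ ht₁)
        rw [hdF' x hx, hFd x]
        simp only [hx2, hx, hxt, not_false_eq_true, and_self, if_true, if_false, add_zero]
        exact CharTwo.add_self_eq_zero _
      · rw [degIn_eq_zero hF'w hx2, hr x (by simp [hx, hx2])]
        simp)
    (by
      rw [Finset.sum_add_distrib, hs, zero_add]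
      exact handshake _ fun e he =>
        hl e (Multiset.mem_of_le hF (Multiset.mem_of_le hF'F he)))
  have hmono1 : K ≤ K + F' := Multiset.le_add_right _ _
  have hmono2 : F' ≤ K + F' := Multiset.le_add_left _ _
  refine ⟨K + F', ?_, ⟨⟨t, Or.inl ht₁⟩, ?_, ?_⟩, ?_⟩
  · rw [Multiset.le_iff_count]
    intro e
    rw [Multiset.count_add, Multiset.count_union]
    by_cases he : ∀ v ∈ e, v ∈ S₁
    · have : Multiset.count e F' = 0 := by
        rw [Multiset.count_eq_zero, hF', Multiset.mem_filter]
        exact fun hh => hh.2 he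
      rw [this, add_zero]
      exact le_max_of_le_left (Multiset.count_le_of_le e hK)
    · have : Multiset.count e K = 0 := by
        rw [Multiset.count_eq_zero]
        exact fun hh => he (hKc.2.1 e hh)
      rw [this, zero_add]
      exact le_max_of_le_right (Multiset.count_le_of_le e (hF'F.trans hF))
  · intro e he x hx
    rcases Multiset.mem_add.1 he with he | he
    · exact Or.inl (hKc.2.1 e he x hx)
    · exact Or.inr (hF'w e he x hx)
  · have hall : ∀ a ∈ S₁ ∪ S₂, Reach (K + F') a t := by
      rintro a (ha | ha)
      · exact Reach.mono hmono1 (hKc.2.2 a ha t ht₁)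
      · have : Reach F a t := hFc.2.2 a ha t ht₂
        refine this.bind fun p q hpq => ?_
        by_cases he : ∀ v ∈ s(p, q), v ∈ S₁
        · exact Reach.mono hmono1 (hKc.2.2 p (he p (by simp)) q (he q (by simp)))
        · exact Reach.mono hmono2 (Reach.edge (Multiset.mem_filter.2 ⟨hpq, he⟩))
    intro a ha b hb
    exact (hall a ha).tr (hall b hb).sy
  · intro x _
    rw [degIn_add, Nat.cast_add, hKd x, add_assoc, CharTwo.add_self_eq_zero, add_zero]

lemma exists_of_le_map {A B : Type} (f : A → B) (M : Multiset A) (N : Multiset B)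
    (h : N ≤ M.map f) : ∃ N' ≤ M, N = N'.map f := by
  induction M using Multiset.induction_on generalizing N with
  | empty => exact ⟨0, le_rfl, by simpa using h⟩
  | cons a M ih =>
    rw [Multiset.map_cons] at h
    by_cases ha : f a ∈ N
    · obtain ⟨N', hN', he⟩ := ih (N.erase (f a)) (by
        rw [Multiset.erase_le_iff_le_cons]; exact h)
      refine ⟨a ::ₘ N', Multiset.cons_le_cons _ hN', ?_⟩
      rw [Multiset.map_cons, ← he, Multiset.cons_erase ha]
    · obtain ⟨N', hN', he⟩ := ih N ((Multiset.le_cons_of_notMem ha).1 h)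
      exact ⟨N', hN'.trans (Multiset.le_cons_self _ _), he⟩

lemma choose_D (u v z w : V)
    (huv : u ≠ v) (huz : u ≠ z) (huw : u ≠ w) (hvz : v ≠ z) (hvw : v ≠ w) (hzw : z ≠ w)
    (Γ : Multiset (Sym2 V)) (d : V → ZMod 2)
    (h0 : ∀ x, x ≠ u → x ≠ v → x ≠ z → x ≠ w → d x = 0)
    (hpar : d u + d z = d v + d w)
    (hlink : d u = d z → Reach Γ u v ∨ Reach Γ u w ∨ Reach Γ z v ∨ Reach Γ z w) :
    ∃ D ≤ ({s(u, v), s(v, z), s(z, w), s(w, u)} : Multiset (Sym2 V)),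
      (∀ x, (degIn D x : ZMod 2) = d x) ∧
      Reach (Γ + D) u z ∧ Reach (Γ + D) u v ∧ Reach (Γ + D) v w := by
  have key : ∀ D ≤ ({s(u, v), s(v, z), s(z, w), s(w, u)} : Multiset (Sym2 V)),
      (degIn D u : ZMod 2) = d u → (degIn D v : ZMod 2) = d v →
      (degIn D z : ZMod 2) = d z → (degIn D w : ZMod 2) = d w →
      ∀ x, (degIn D x : ZMod 2) = d x := by
    intro D hD hu hv hz hw x
    by_cases xu : x = u
    · rw [xu, hu]
    by_cases xv : x = v
    · rw [xv, hv]
    by_cases xz : x = z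
    · rw [xz, hz]
    by_cases xw : x = w
    · rw [xw, hw]
    rw [h0 x xu xv xz xw, degIn_eq_zero (S := {u, v, z, w}) (E := D), Nat.cast_zero]
    · intro e he y hy
      have := Multiset.mem_of_le hD he
      simp only [Multiset.insert_eq_cons, Multiset.mem_cons, Multiset.mem_singleton] at this
      simp only [Set.mem_insert_iff, Set.mem_singleton_iff]
      rcases this with rfl | rfl | rfl | rfl <;> simp only [Sym2.mem_iff] at hy <;> tauto
    · simp [xu, xv, xz, xw]
  have star : ∀ F : Multiset (Sym2 V), Reach F u v → Reach F v z → Reach F z w →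
      Reach F u z ∧ Reach F u v ∧ Reach F v w := fun F h1 h2 h3 =>
    ⟨h1.tr h2, h1, h2.tr h3⟩
  have hm : ∀ D : Multiset (Sym2 V), ∀ a b, s(a, b) ∈ D → Reach (Γ + D) a b := fun D a b h =>
    Reach.edge (Multiset.mem_add.2 (Or.inr h))
  have h11 : (1 : ZMod 2) + 1 = 0 := by decide
  have huv' := huv.symm
  have huz' := huz.symm
  have huw' := huw.symm
  have hvz' := hvz.symm
  have hvw' := hvw.symm
  have hzw' := hzw.symm
  have mk : ∀ D ≤ ({s(u, v), s(v, z), s(z, w), s(w, u)} : Multiset (Sym2 V)),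
      (degIn D u : ZMod 2) = d u ∧ (degIn D v : ZMod 2) = d v ∧
      (degIn D z : ZMod 2) = d z ∧ (degIn D w : ZMod 2) = d w →
      (Reach (Γ + D) u z ∧ Reach (Γ + D) u v ∧ Reach (Γ + D) v w) →
      ∃ D ≤ ({s(u, v), s(v, z), s(z, w), s(w, u)} : Multiset (Sym2 V)),
      (∀ x, (degIn D x : ZMod 2) = d x) ∧
      Reach (Γ + D) u z ∧ Reach (Γ + D) u v ∧ Reach (Γ + D) v w :=
    fun D hD h1 h2 => ⟨D, hD, key D hD h1.1 h1.2.1 h1.2.2.1 h1.2.2.2, h2⟩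
  have sub : ∀ a b c e : ℕ, a ≤ 1 → b ≤ 1 → c ≤ 1 → e ≤ 1 →
      a • {s(u, v)} + b • {s(v, z)} + c • {s(z, w)} + e • {s(w, u)} ≤
      ({s(u, v), s(v, z), s(z, w), s(w, u)} : Multiset (Sym2 V)) := by
    intro a b c e ha hb hc he
    have : ({s(u, v), s(v, z), s(z, w), s(w, u)} : Multiset (Sym2 V)) =
        1 • {s(u, v)} + 1 • {s(v, z)} + 1 • {s(z, w)} + 1 • {s(w, u)} := by
      simp only [one_nsmul]
      rfl
    rw [this]
    gcongr
  have dn : ∀ (n : ℕ) (e : Sym2 V) (x : V), degIn (n • {e}) x = n * if x ∈ e then 1 else 0 := by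
    intro n e x
    induction n with
    | zero => simp [degIn_zero]
    | succ n ih => rw [succ_nsmul, degIn_add, ih, degIn_singleton, Nat.succ_mul]
  have mk' : ∀ a b c e : ℕ, a ≤ 1 → b ≤ 1 → c ≤ 1 → e ≤ 1 →
      ((a + e : ℕ) : ZMod 2) = d u → ((a + b : ℕ) : ZMod 2) = d v →
      ((b + c : ℕ) : ZMod 2) = d z → ((c + e : ℕ) : ZMod 2) = d w →
      ((∀ F, Γ ≤ F → (a = 1 → Reach F u v) → (b = 1 → Reach F v z) → (c = 1 → Reach F z w) →
        (e = 1 → Reach F w u) → Reach F u z ∧ Reach F u v ∧ Reach F v w)) →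
      ∃ D ≤ ({s(u, v), s(v, z), s(z, w), s(w, u)} : Multiset (Sym2 V)),
      (∀ x, (degIn D x : ZMod 2) = d x) ∧
      Reach (Γ + D) u z ∧ Reach (Γ + D) u v ∧ Reach (Γ + D) v w := by
    intro a b c e ha hb hc he hu hv hz hw hF
    refine mk _ (sub a b c e ha hb hc he) ?_ ?_
    · rw [← hu, ← hv, ← hz, ← hw]
      simp only [degIn_add, dn]
      simp [*]
    · refine hF _ (Multiset.le_add_right _ _) ?_ ?_ ?_ ?_ <;> rintro rfl <;>
        refine hm _ _ _ ?_ <;> simp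
  rcases zmod_cases (d u) with hu | hu <;> rcases zmod_cases (d v) with hv | hv <;>
    rcases zmod_cases (d z) with hz | hz <;> rcases zmod_cases (d w) with hw | hw <;>
    rw [hu, hv, hz, hw] at hpar <;> (try exact absurd hpar (by decide)) <;>
    rw [hu, hz] at hlink <;> rw [hu, hv, hz, hw] at mk'
  · exact mk' 1 1 1 1 le_rfl le_rfl le_rfl le_rfl (by decide) (by decide) (by decide) (by decide)
      fun F _ h1 h2 h3 _ => star F (h1 rfl) (h2 rfl) (h3 rfl)
  · exact mk' 1 1 0 1 le_rfl le_rfl zero_le_one le_rfl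
      (by decide) (by decide) (by decide) (by decide)
      fun F _ h1 h2 _ h4 => star F (h1 rfl) (h2 rfl)
        ((h2 rfl).sy.tr ((h1 rfl).sy.tr (h4 rfl).sy))
  · have A := mk' 1 0 0 1 le_rfl zero_le_one zero_le_one le_rfl
      (by decide) (by decide) (by decide) (by decide)
    have B := mk' 0 1 1 0 zero_le_one le_rfl le_rfl zero_le_one
      (by decide) (by decide) (by decide) (by decide)
    rcases hlink rfl with hl | hl | hl | hl
    · refine B fun F hF _ h2 h3 _ => ?_
      have := hl.mono hF
      exact star F this (h2 rfl) (h3 rfl)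
    · refine B fun F hF _ h2 h3 _ => ?_
      have := hl.mono hF
      exact star F (this.tr ((h3 rfl).sy.tr (h2 rfl).sy)) (h2 rfl) (h3 rfl)
    · refine A fun F hF h1 _ _ h4 => ?_
      have := hl.mono hF
      exact star F (h1 rfl) this.sy (this.tr ((h1 rfl).sy.tr (h4 rfl).sy))
    · refine A fun F hF h1 _ _ h4 => ?_
      have := hl.mono hF
      exact star F (h1 rfl) ((h1 rfl).sy.tr ((h4 rfl).sy.tr this.sy)) this
  · exact mk' 1 0 1 1 le_rfl zero_le_one le_rfl le_rfl
      (by decide) (by decide) (by decide) (by decide)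
      fun F _ h1 _ h3 h4 => star F (h1 rfl) ((h1 rfl).sy.tr ((h4 rfl).sy.tr (h3 rfl).sy)) (h3 rfl)
  · exact mk' 1 1 1 0 le_rfl le_rfl le_rfl zero_le_one
      (by decide) (by decide) (by decide) (by decide)
      fun F _ h1 h2 h3 _ => star F (h1 rfl) (h2 rfl) (h3 rfl)
  · have A := mk' 0 0 1 1 zero_le_one zero_le_one le_rfl le_rfl
      (by decide) (by decide) (by decide) (by decide)
    have B := mk' 1 1 0 0 le_rfl le_rfl zero_le_one zero_le_one
      (by decide) (by decide) (by decide) (by decide)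
    rcases hlink rfl with hl | hl | hl | hl
    · refine A fun F hF _ _ h3 h4 => ?_
      have := hl.mono hF
      exact star F this (this.sy.tr ((h4 rfl).sy.tr (h3 rfl).sy)) (h3 rfl)
    · refine B fun F hF h1 h2 _ _ => ?_
      have := hl.mono hF
      exact star F (h1 rfl) (h2 rfl) ((h2 rfl).sy.tr ((h1 rfl).sy.tr this))
    · refine A fun F hF _ _ h3 h4 => ?_
      have := hl.mono hF
      exact star F ((h4 rfl).sy.tr ((h3 rfl).sy.tr this)) this.sy (h3 rfl)
    · refine B fun F hF h1 h2 _ _ => ?_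
      have := hl.mono hF
      exact star F (h1 rfl) (h2 rfl) this
  · exact mk' 0 1 1 1 zero_le_one le_rfl le_rfl le_rfl
      (by decide) (by decide) (by decide) (by decide)
      fun F _ _ h2 h3 h4 => star F ((h4 rfl).sy.tr ((h3 rfl).sy.tr (h2 rfl).sy)) (h2 rfl) (h3 rfl)
  · have A := mk' 0 1 0 1 zero_le_one le_rfl zero_le_one le_rfl
      (by decide) (by decide) (by decide) (by decide)
    have B := mk' 1 0 1 0 le_rfl zero_le_one le_rfl zero_le_one
      (by decide) (by decide) (by decide) (by decide)
    rcases hlink rfl with hl | hl | hl | hl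
    · refine A fun F hF _ h2 _ h4 => ?_
      have := hl.mono hF
      exact star F this (h2 rfl) ((h2 rfl).sy.tr (this.sy.tr (h4 rfl).sy))
    · refine B fun F hF h1 _ h3 _ => ?_
      have := hl.mono hF
      exact star F (h1 rfl) ((h1 rfl).sy.tr (this.tr (h3 rfl).sy)) (h3 rfl)
    · refine B fun F hF h1 _ h3 _ => ?_
      have := hl.mono hF
      exact star F (h1 rfl) this.sy (h3 rfl)
    · refine A fun F hF _ h2 _ h4 => ?_
      have := hl.mono hF
      exact star F ((h4 rfl).sy.tr (this.sy.tr (h2 rfl).sy)) (h2 rfl) this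

/-- The identification map of the π-reduction. -/
noncomputable def piMap (u v z w : V) : V → V :=
  fun a => if a = z then u else if a = w then v else a

lemma not_mem_of_isolated {S : Set V} {E : Multiset (Sym2 V)} (h : CollapsiblePair S E)
    {x s : V} (hs : s ∈ S) (hsx : s ≠ x) (hx : ∀ e ∈ E, x ∉ e) : x ∉ S := by
  intro hxS
  obtain ⟨E', hE', hc, -⟩ := h.2.2 ∅ (Set.empty_subset _) Set.finite_empty (by simp)
  rcases Relation.ReflTransGen.cases_head (hc.2.2 x hxS s hs) with h | ⟨c, h, -⟩
  · exact hsx h.symm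
  · exact hx _ (Multiset.mem_of_le hE' h) (by simp)

lemma inducedEdges_le (G : Multigraph V) (S : Set V) : G.inducedEdges S ≤ G.edges :=
  Multiset.filter_le _ _

lemma inducedEdges_within (G : Multigraph V) (S : Set V) : Within S (G.inducedEdges S) :=
  fun _ he => (Multiset.mem_filter.1 he).2

lemma le_inducedEdges (G : Multigraph V) (S : Set V) (E : Multiset (Sym2 V))
    (h : E ≤ G.edges) (hw : Within S E) : E ≤ G.inducedEdges S :=
  Multiset.le_filter.2 ⟨h, hw⟩

lemma link_of_map (u v z w : V)
    (huv : u ≠ v) (huw : u ≠ w) (hvz : v ≠ z) (hzw : z ≠ w)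
    (Γ : Multiset (Sym2 V)) (h : Reach (Γ.map (Sym2.map (piMap u v z w))) u v) :
    Reach Γ u v ∨ Reach Γ u w ∨ Reach Γ z v ∨ Reach Γ z w := by
  by_contra hcon
  have hv : ¬ (Reach Γ u v ∨ Reach Γ z v) := by tauto
  have hw : ¬ (Reach Γ u w ∨ Reach Γ z w) := by tauto
  have main : ∀ p, Reach (Γ.map (Sym2.map (piMap u v z w))) u p →
      (Reach Γ u p ∨ Reach Γ z p) := by
    intro p hp
    induction hp with
    | refl => exact Or.inl Reach.rfl'
    | @tail b c _ h2 ih =>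
      have step : ∀ a a', s(a, a') ∈ Γ → piMap u v z w a = b → piMap u v z w a' = c →
          (Reach Γ u c ∨ Reach Γ z c) := by
        intro a a' haa' hb hc
        have ha : Reach Γ u a ∨ Reach Γ z a := by
          unfold piMap at hb
          split_ifs at hb with h1 h2
          · subst h1; exact Or.inr Reach.rfl'
          · subst hb; exact absurd ih hv
          · subst hb; exact ih
        have ha' : Reach Γ u a' ∨ Reach Γ z a' := by
          rcases ha with ha | ha
          · exact Or.inl (ha.tr (Reach.edge haa'))
          · exact Or.inr (ha.tr (Reach.edge haa'))
        unfold piMap at hc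
        split_ifs at hc with h1 h2
        · subst hc; exact Or.inl Reach.rfl'
        · subst h2; exact absurd ha' hw
        · subst hc; exact ha'
      obtain ⟨e, he, hmap⟩ := Multiset.mem_map.1 h2
      induction e using Sym2.ind with
      | _ a a' =>
        rw [Sym2.map_mk, Sym2.eq_iff] at hmap
        rcases hmap with ⟨h1, h2⟩ | ⟨h1, h2⟩
        · exact step a a' he h1 h2
        · exact step a' a (by rwa [Sym2.eq_swap]) h2 h1
  exact hv (main v h)

lemma pi_lift [Fintype V] (G : Multigraph V) (u v z w : V)
    (huv : u ≠ v) (huz : u ≠ z) (huw : u ≠ w) (hvz : v ≠ z) (hvw : v ≠ w) (hzw : z ≠ w)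
    (e₁ : s(u, v) ∈ G.edges) (e₂ : s(v, z) ∈ G.edges)
    (e₃ : s(z, w) ∈ G.edges) (e₄ : s(w, u) ∈ G.edges)
    (Gπ : Multigraph V) (hGπ : Gπ.edges = G.piEdges u v z w)
    (S : Set V) (E : Multiset (Sym2 V)) (hE : E ≤ Gπ.edges) (hcol : CollapsiblePair S E)
    (hu : u ∈ S) (hv : v ∈ S) :
    CollapsiblePair (S ∪ {z, w}) (G.inducedEdges (S ∪ {z, w})) := by
  set φ := piMap u v z w with hφ
  have hφu : φ u = u := by simp [hφ, piMap, huz, huw]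
  have hφv : φ v = v := by simp [hφ, piMap, hvz, hvw]
  have hφz : φ z = u := by simp [hφ, piMap]
  have hφw : φ w = v := by simp [hφ, piMap, hzw.symm]
  have hφo : ∀ a, a ≠ z → a ≠ w → φ a = a := fun a h1 h2 => by simp [hφ, piMap, h1, h2]
  have hφT : ∀ a, a ∈ S ∪ {z, w} → φ a ∈ S := by
    intro a ha
    by_cases h1 : a = z
    · rw [h1, hφz]; exact hu
    by_cases h2 : a = w
    · rw [h2, hφw]; exact hv
    rw [hφo a h1 h2]
    simpa [h1, h2] using ha
  have hφT' : ∀ a, φ a ∈ S → a ∈ S ∪ {z, w} := by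
    intro a ha
    by_cases h1 : a = z
    · simp [h1]
    by_cases h2 : a = w
    · simp [h2]
    rw [hφo a h1 h2] at ha
    exact Or.inl ha
  have hpi : Gπ.edges = (G.edges - {s(u, v), s(v, z), s(z, w), s(w, u)}).map (Sym2.map φ)
      + {s(u, v)} := hGπ
  have hC : ({s(u, v), s(v, z), s(z, w), s(w, u)} : Multiset (Sym2 V)) ≤ G.edges := by
    rw [Multiset.le_iff_subset]
    · intro e he
      simp only [Multiset.insert_eq_cons, Multiset.mem_cons, Multiset.mem_singleton] at he
      rcases he with rfl | rfl | rfl | rfl <;> assumption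
    · simp [huv, huz, huw, hvz, hvw, hzw, huv.symm, huz.symm, huw.symm, hvz.symm, hvw.symm,
        hzw.symm]
  have sumu : ∀ g : V → ZMod 2, (∑ a, if φ a = u then g a else 0) = g u + g z := by
    intro g
    have : ∀ a, (if φ a = u then g a else 0) =
        (if a = u then g u else 0) + (if a = z then g z else 0) := by
      intro a
      by_cases h1 : a = z
      · subst h1; simp [hφz, huz.symm]
      by_cases h2 : a = w
      · subst h2; simp [hφw, huv.symm, huw.symm, h1]
      rw [hφo a h1 h2]
      by_cases h3 : a = u
      · subst h3; simp [h1]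
      · simp [h1, h3]
    simp only [this, Finset.sum_add_distrib, Finset.sum_ite_eq', Finset.mem_univ, if_true]
  have sumv : ∀ g : V → ZMod 2, (∑ a, if φ a = v then g a else 0) = g v + g w := by
    intro g
    have : ∀ a, (if φ a = v then g a else 0) =
        (if a = v then g v else 0) + (if a = w then g w else 0) := by
      intro a
      by_cases h1 : a = z
      · subst h1; simp [hφz, huv, hvz.symm, hzw]
      by_cases h2 : a = w
      · subst h2; simp [hφw, hvw.symm]
      rw [hφo a h1 h2]
      by_cases h3 : a = v
      · subst h3; simp [h2]
      · simp [h2, h3]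
    simp only [this, Finset.sum_add_distrib, Finset.sum_ite_eq', Finset.mem_univ, if_true]
  have sumo : ∀ g : V → ZMod 2, ∀ x, x ≠ u → x ≠ v → x ≠ z → x ≠ w →
      (∑ a, if φ a = x then g a else 0) = g x := by
    intro g x xu xv xz xw
    have : ∀ a, (if φ a = x then g a else 0) = (if a = x then g x else 0) := by
      intro a
      by_cases h1 : a = z
      · subst h1; simp [hφz, xu.symm, xz.symm]
      by_cases h2 : a = w
      · subst h2; simp [hφw, xv.symm, xw.symm]
      rw [hφo a h1 h2]
      by_cases h3 : a = x
      · subst h3; simp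
      · simp [h3]
    simp only [this, Finset.sum_ite_eq', Finset.mem_univ, if_true]
  refine collapsible_of_fun ⟨u, Or.inl hu⟩ (G.inducedEdges_within _) ?_
  intro r hr hs
  obtain ⟨Γ', hΓ', hc, hd⟩ := hcol.exists_fun (fun x => ∑ a, if φ a = x then r a else 0)
    (fun x hx => Finset.sum_eq_zero fun a _ => by
      split_ifs with h
      · exact hr a fun ha => hx (h ▸ hφT a ha)
      · rfl)
    (by
      rw [Finset.sum_comm]
      simp only [Finset.sum_ite_eq, Finset.mem_univ, if_true]
      exact hs)
  obtain ⟨Γ, hΓ, k, hk1, hΓ'eq⟩ : ∃ Γ ≤ G.edges - {s(u, v), s(v, z), s(z, w), s(w, u)},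
      ∃ k : ℕ, k ≤ 1 ∧ Γ' = Γ.map (Sym2.map φ) + k • {s(u, v)} := by
    have hle : Γ' ≤ s(u, v) ::ₘ
        (G.edges - {s(u, v), s(v, z), s(z, w), s(w, u)}).map (Sym2.map φ) := by
      refine (hΓ'.trans hE).trans (le_of_eq ?_)
      rw [hpi, add_comm, Multiset.singleton_add]
    by_cases hmem : s(u, v) ∈ Γ'
    · obtain ⟨Γ, hΓ, he⟩ := exists_of_le_map _ _ _ (Multiset.erase_le_iff_le_cons.2 hle)
      refine ⟨Γ, hΓ, 1, le_rfl, ?_⟩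
      rw [← he, one_nsmul, add_comm, Multiset.singleton_add, Multiset.cons_erase hmem]
    · obtain ⟨Γ, hΓ, he⟩ := exists_of_le_map _ _ _ ((Multiset.le_cons_of_notMem hmem).1 hle)
      exact ⟨Γ, hΓ, 0, zero_le_one, by simp [he]⟩
  have hsubmap : Γ.map (Sym2.map φ) ≤ Γ' := by
    rw [hΓ'eq]; exact Multiset.le_add_right _ _
  have hdm := degIn_map φ Γ (fun e he => Gπ.loopless e
    (Multiset.mem_of_le (hsubmap.trans (hΓ'.trans hE)) he))
  set d : V → ZMod 2 := fun x => r x + (degIn Γ x : ZMod 2) with hdd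
  have hdk : ∀ x, degIn (k • {s(u, v)}) x = if x = u ∨ x = v then k else 0 := by
    intro x
    interval_cases k
    · simp [degIn_zero]
    · rw [one_nsmul, degIn_singleton]; simp
  have hsum : ∀ x, (∑ a, if φ a = x then d a else 0) =
      ((if x = u ∨ x = v then k else 0 : ℕ) : ZMod 2) := by
    intro x
    have h1 : (∑ a, if φ a = x then d a else 0) = (∑ a, if φ a = x then r a else 0) +
        (degIn (Γ.map (Sym2.map φ)) x : ZMod 2) := by
      rw [hdm x, Nat.cast_sum, ← Finset.sum_add_distrib]
      refine Finset.sum_congr rfl fun a _ => ?_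
      split_ifs <;> simp [hdd]
    have h2 := hd x
    rw [h1, ← h2, hΓ'eq, degIn_add, hdk, Nat.cast_add, add_right_comm,
      CharTwo.add_self_eq_zero, zero_add]
  have hdu : d u + d z = (k : ZMod 2) := by rw [← sumu, hsum]; simp
  have hdv : d v + d w = (k : ZMod 2) := by rw [← sumv, hsum]; simp
  obtain ⟨D, hD, hDd, c1, c2, c3⟩ := choose_D u v z w huv huz huw hvz hvw hzw Γ d
    (fun x xu xv xz xw => by
      rw [← sumo d x xu xv xz xw, hsum]; simp [xu, xv])
    (by rw [hdu, hdv])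
    (by
      intro heq
      rw [heq, CharTwo.add_self_eq_zero] at hdu
      have hk0 : k = 0 := by
        interval_cases k
        · rfl
        · exact absurd hdu (by decide)
      rw [hk0, zero_nsmul, add_zero] at hΓ'eq
      refine link_of_map u v z w huv huw hvz hzw Γ ?_
      rw [← hφ, ← hΓ'eq]
      exact hc.2.2 u hu v hv)
  have hwit : Within (S ∪ {z, w}) (Γ + D) := by
    intro e he x hx
    rcases Multiset.mem_add.1 he with he | he
    · apply hφT'
      refine hc.2.1 (Sym2.map φ e) (Multiset.mem_of_le hsubmap (Multiset.mem_map_of_mem _ he)) _ ?_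
      exact Sym2.mem_map.2 ⟨x, hx, rfl⟩
    · have := Multiset.mem_of_le hD he
      simp only [Multiset.insert_eq_cons, Multiset.mem_cons, Multiset.mem_singleton] at this
      rcases this with rfl | rfl | rfl | rfl <;> simp only [Sym2.mem_iff] at hx <;>
        rcases hx with rfl | rfl <;> simp [hu, hv]
  refine ⟨Γ + D, ?_, ⟨⟨u, Or.inl hu⟩, hwit, ?_⟩, ?_⟩
  · refine le_inducedEdges _ _ _ ?_ hwit
    calc Γ + D ≤ (G.edges - {s(u, v), s(v, z), s(z, w), s(w, u)}) +
        {s(u, v), s(v, z), s(z, w), s(w, u)} := add_le_add hΓ hD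
      _ = G.edges := Multiset.sub_add_cancel hC
  · have hr1 : ∀ a, Reach (Γ + D) a (φ a) := by
      intro a
      by_cases h1 : a = z
      · rw [h1, hφz]; exact c1.sy
      by_cases h2 : a = w
      · rw [h2, hφw]; exact c3.sy
      rw [hφo a h1 h2]
      exact Reach.rfl'
    have hr2 : ∀ p q, s(p, q) ∈ Γ' → Reach (Γ + D) p q := by
      intro p q hpq
      rw [hΓ'eq] at hpq
      rcases Multiset.mem_add.1 hpq with h | h
      · obtain ⟨e, he, hmap⟩ := Multiset.mem_map.1 h
        induction e using Sym2.ind with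
        | _ a b =>
          have hab : Reach (Γ + D) a b := Reach.edge (Multiset.mem_add.2 (Or.inl he))
          have hab' := (hr1 a).sy.tr (hab.tr (hr1 b))
          rw [Sym2.map_mk, Sym2.eq_iff] at hmap
          rcases hmap with ⟨h1, h2⟩ | ⟨h1, h2⟩
          · rw [← h1, ← h2]; exact hab'
          · rw [← h1, ← h2]; exact hab'.sy
      · have := Multiset.mem_of_mem_nsmul h
        rw [Multiset.mem_singleton, Sym2.eq_iff] at this
        rcases this with ⟨rfl, rfl⟩ | ⟨rfl, rfl⟩
        · exact c2
        · exact c2.sy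
    intro a ha b hb
    have h1 : Reach Γ' (φ a) (φ b) := hc.2.2 _ (hφT a ha) _ (hφT b hb)
    exact (hr1 a).tr ((h1.bind hr2).tr (hr1 b).sy)
  · intro x _
    rw [degIn_add, Nat.cast_add, hDd x, hdd]
    simp only
    rw [add_comm, add_assoc, CharTwo.add_self_eq_zero, add_zero]

end Helpers

end Multigraph

/-- part of Lemma 2.1. Let `G` be a connected reduced graph with minimum
degree at least 3, let `u v z w u` be an (induced) 4-cycle of `G`, and let `G/π` be obtained
from `G` by the π-reduction on this 4-cycle, with new edge `e_π = xy` where `x` (here `u`)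
is the identification of `u, z` and `y` (here `v`) is the identification of `v, w`.
Then `G/π` has at most two nontrivial maximal collapsible subgraphs, and every nontrivial
maximal collapsible subgraph of `G/π` contains exactly one of the vertices `x`, `y`. -/
theorem statement0 {V : Type} [Fintype V] (G : Multigraph V)
    (hconn : G.Connected) (hred : G.Reduced) (hδ : ∀ x : V, 3 ≤ G.deg x)
    (u v z w : V)
    (huv : u ≠ v) (huz : u ≠ z) (huw : u ≠ w) (hvz : v ≠ z) (hvw : v ≠ w) (hzw : z ≠ w)
    (e₁ : s(u, v) ∈ G.edges) (e₂ : s(v, z) ∈ G.edges)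
    (e₃ : s(z, w) ∈ G.edges) (e₄ : s(w, u) ∈ G.edges)
    (hind₁ : s(u, z) ∉ G.edges) (hind₂ : s(v, w) ∉ G.edges)
    (Gπ : Multigraph V) (hGπ : Gπ.edges = G.piEdges u v z w) :
    (∀ p₁ p₂ p₃ : Set V × Multiset (Sym2 V),
        Gπ.NontrivMaxCollapsible p₁.1 p₁.2 → Gπ.NontrivMaxCollapsible p₂.1 p₂.2 →
          Gπ.NontrivMaxCollapsible p₃.1 p₃.2 → p₁ = p₂ ∨ p₁ = p₃ ∨ p₂ = p₃) ∧
      ∀ S E, Gπ.NontrivMaxCollapsible S E → (u ∈ S ∧ v ∉ S) ∨ (u ∉ S ∧ v ∈ S) := by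
  have hpi : Gπ.edges = (G.edges - {s(u, v), s(v, z), s(z, w), s(w, u)}).map
      (Sym2.map (Multigraph.piMap u v z w)) + {s(u, v)} := hGπ
  have hmap : ∀ a, Multigraph.piMap u v z w a ≠ z ∧ Multigraph.piMap u v z w a ≠ w := by
    intro a
    unfold Multigraph.piMap
    split_ifs with h1 h2
    · exact ⟨huz, huw⟩
    · exact ⟨hvz, hvw⟩
    · exact ⟨h1, h2⟩
  have hiso : ∀ e ∈ Gπ.edges, z ∉ e ∧ w ∉ e := by
    intro e he
    rw [hpi] at he
    rcases Multiset.mem_add.1 he with he | he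
    · obtain ⟨e', -, rfl⟩ := Multiset.mem_map.1 he
      simp only [Sym2.mem_map, not_exists, not_and]
      exact ⟨fun a _ => (hmap a).1, fun a _ => (hmap a).2⟩
    · rw [Multiset.mem_singleton] at he
      subst he
      simp [huz.symm, hvz.symm, huw.symm, hvw.symm]
  have part2 : ∀ S E, Gπ.NontrivMaxCollapsible S E →
      (u ∈ S ∧ v ∉ S) ∨ (u ∉ S ∧ v ∈ S) := by
    intro S E h
    have hE : E ≤ Gπ.edges := h.1.1.1
    have hcol := h.1.2.1
    by_cases hu : u ∈ S <;> by_cases hv : v ∈ S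
    · exfalso
      have hc := Multigraph.pi_lift G u v z w huv huz huw hvz hvw hzw e₁ e₂ e₃ e₄ Gπ hGπ S E hE
        hcol hu hv
      have h1 := hred _ _ ⟨G.inducedEdges_le _, hc.2.1⟩ hc
      have h2 : 1 < (S ∪ {z, w}).ncard :=
        lt_of_lt_of_le h.2 (Set.ncard_le_ncard Set.subset_union_left (Set.toFinite _))
      omega
    · exact Or.inl ⟨hu, hv⟩
    · exact Or.inr ⟨hu, hv⟩
    · exfalso
      have hSn : ∀ x, (∀ e ∈ E, x ∉ e) → x ∉ S := by
        intro x hx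
        obtain ⟨s, hs, hsx⟩ := Set.exists_ne_of_one_lt_ncard h.2 x
        exact Multigraph.not_mem_of_isolated hcol hs hsx hx
      have hEe : ∀ e ∈ E, u ∉ e ∧ v ∉ e := fun e he =>
        ⟨fun hh => hu (hcol.2.1 e he u hh), fun hh => hv (hcol.2.1 e he v hh)⟩
      have hle : E ≤ (G.edges - {s(u, v), s(v, z), s(z, w), s(w, u)}).map
          (Sym2.map (Multigraph.piMap u v z w)) := by
        have hle : E ≤ s(u, v) ::ₘ (G.edges - {s(u, v), s(v, z), s(z, w), s(w, u)}).map
            (Sym2.map (Multigraph.piMap u v z w)) := by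
          refine hE.trans (le_of_eq ?_)
          rw [hpi, add_comm, Multiset.singleton_add]
        exact (Multiset.le_cons_of_notMem fun hh => (hEe _ hh).1 (by simp)).1 hle
      obtain ⟨N, hN, hNE⟩ := Multigraph.exists_of_le_map _ _ _ hle
      have hid : N.map (Sym2.map (Multigraph.piMap u v z w)) = N.map id := by
        refine Multiset.map_congr rfl fun e he => ?_
        have h1 := hEe (Sym2.map (Multigraph.piMap u v z w) e)
          (by rw [hNE]; exact Multiset.mem_map_of_mem _ he)
        have h2 : ∀ a ∈ e, Multigraph.piMap u v z w a = a := by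
          intro a ha
          have h3 : Multigraph.piMap u v z w a ≠ u := fun hh =>
            h1.1 (Sym2.mem_map.2 ⟨a, ha, hh⟩)
          have h4 : Multigraph.piMap u v z w a ≠ v := fun hh =>
            h1.2 (Sym2.mem_map.2 ⟨a, ha, hh⟩)
          unfold Multigraph.piMap at h3 h4 ⊢
          split_ifs at h3 h4 ⊢ <;> simp_all
        rw [Sym2.map_congr h2, Sym2.map_id']
      rw [Multiset.map_id] at hid
      have hEG : E ≤ G.edges := by
        rw [hNE, hid]
        exact hN.trans (Multiset.sub_le_self _ _)
      have h1 := hred S E ⟨hEG, hcol.2.1⟩ hcol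
      have h2 := h.2
      omega
  refine ⟨?_, part2⟩
  have huniq : ∀ p q : Set V × Multiset (Sym2 V), Gπ.NontrivMaxCollapsible p.1 p.2 →
      Gπ.NontrivMaxCollapsible q.1 q.2 → ∀ t, t ∈ p.1 → t ∈ q.1 → p = q := by
    intro p q hp hq t htp htq
    have hcol := Multigraph.collapsible_union hp.1.2.1 hq.1.2.1
      (fun e he => Gπ.loopless e (Multiset.mem_of_le hq.1.1.1 he)) htp htq
    have hsub : Gπ.IsSubpair (p.1 ∪ q.1) (p.2 ∪ q.2) :=
      ⟨Multiset.union_le hp.1.1.1 hq.1.1.1, hcol.2.1⟩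
    have h1 := hp.1.2.2 _ _ hsub hcol Set.subset_union_left Multiset.le_union_left
    have h2 := hq.1.2.2 _ _ hsub hcol Set.subset_union_right Multiset.le_union_right
    exact Prod.ext (h1.1.symm.trans h2.1) (h1.2.symm.trans h2.2)
  intro p₁ p₂ p₃ h₁ h₂ h₃
  have q₁ := part2 _ _ h₁
  have q₂ := part2 _ _ h₂
  have q₃ := part2 _ _ h₃
  have a12 := huniq p₁ p₂ h₁ h₂
  have a13 := huniq p₁ p₃ h₁ h₃
  have a23 := huniq p₂ p₃ h₂ h₃
  rcases q₁ with q₁ | q₁ <;> rcases q₂ with q₂ | q₂ <;> rcases q₃ with q₃ | q₃ <;>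
    first
    | exact Or.inl (a12 u q₁.1 q₂.1)
    | exact Or.inl (a12 v q₁.2 q₂.2)
    | exact Or.inr (Or.inl (a13 u q₁.1 q₃.1))
    | exact Or.inr (Or.inl (a13 v q₁.2 q₃.2))
    | exact Or.inr (Or.inr (a23 u q₂.1 q₃.1))
    | exact Or.inr (Or.inr (a23 v q₂.2 q₃.2))
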